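/- Let g ≥ 3. For every vertex q₀ of the Weierstrass spin graph (the complete graph on Fin (g+1)), the Weierstrass spin group G_{q₀} (the set of composite permutations of all Weierstrass spin chains at q₀) equals the alternating group on Fin g; in particular it is isomorphic to A_g. -/

import Mathlib

theorem card_ne_fin (g : ℕ) (z : Fin (g+1)) :
    Fintype.card {w : Fin (g+1) // w ≠ z} = g := by
  simp [Fintype.card_subtype_compl]

/-- The unique order isomorphism `Fin g ≃o {w : Fin (g+1) // w ≠ z}`. -/
noncomputable def eIso (g : ℕ) (z : Fin (g+1)) : Fin g ≃o {w : Fin (g+1) // w ≠ z} :=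
  Fintype.orderIsoFinOfCardEq _ (card_ne_fin g z)

/-- Given a permutation `f` of `Fin (g+1)` with `f x = y`, the induced permutation
`e_y⁻¹ ∘ f ∘ e_x` of `Fin g` (junk value `1` if `f x ≠ y`). -/
noncomputable def spinPerm (g : ℕ) (f : Equiv.Perm (Fin (g+1))) (x y : Fin (g+1)) :
    Equiv.Perm (Fin g) :=
  if hf : f x = y then
    (eIso g x).toEquiv.trans
      ((f.subtypeEquiv (fun a =>
        not_congr (by rw [← hf]; exact f.injective.eq_iff.symm))).trans
        (eIso g y).toEquiv.symm)
  else 1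

/-- One step of a Weierstrass spin chain: the oriented edge from `q` to `r` of the
complete graph on `Fin (g+1)` together with the choice of the triangle `{q, r, s}`
containing it. -/
structure WStep (g : ℕ) where
  q : Fin (g+1)
  r : Fin (g+1)
  s : Fin (g+1)

namespace WStep

variable {g : ℕ}

/-- The step is valid if the three vertices of its triangle are pairwise distinct. -/
def valid (t : WStep g) : Prop := ([t.q, t.r, t.s] : List (Fin (g+1))).Nodup

/-- Source vertex of the step. -/
def src (t : WStep g) : Fin (g+1) := t.q

/-- Target vertex of the step. -/
def tgt (t : WStep g) : Fin (g+1) := t.r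

/-- The spin permutation of the step: `σ^{{q,r,s}}_{qr} = e_r⁻¹ ∘ f ∘ e_q` for the
3-cycle `f = (q r s)` of `Fin (g+1)`. -/
noncomputable def perm (t : WStep g) : Equiv.Perm (Fin g) :=
  spinPerm g ([t.q, t.r, t.s].formPerm) t.q t.r

end WStep

/-- `l` is a Weierstrass spin chain at the vertex `q₀`: a closed walk at `q₀` in the
complete graph on `Fin (g+1)` (encoded by its list of steps, consecutive steps matching)
together with a choice of a triangle along each edge. -/
def IsWChain (g : ℕ) (q₀ : Fin (g+1)) (l : List (WStep g)) : Prop :=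
  (∀ t ∈ l, t.valid) ∧ List.Chain' (fun t u => t.tgt = u.src) l ∧
    (∀ t ∈ l.head?, t.src = q₀) ∧ (∀ t ∈ l.getLast?, t.tgt = q₀)

/-- The permutation produced by a chain of steps `t₁, …, t_N`: the composite
`σ_{t_N} ∘ ⋯ ∘ σ_{t₁}`. -/
noncomputable def wChainPerm (g : ℕ) (l : List (WStep g)) : Equiv.Perm (Fin g) :=
  (l.map WStep.perm).reverse.prod

/-- The Weierstrass spin group at a vertex `q₀`: the set of permutations produced by all
Weierstrass spin chains at `q₀`. -/
noncomputable def wSpinGroupAt (g : ℕ) (q₀ : Fin (g+1)) : Set (Equiv.Perm (Fin g)) :=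
  {σ | ∃ l : List (WStep g), IsWChain g q₀ l ∧ wChainPerm g l = σ}

theorem eIso_apply (g : ℕ) (z : Fin (g+1)) (i : Fin g) :
    (eIso g z i : Fin (g+1)) = z.succAbove i := by
  rw [Subsingleton.elim (eIso g z) (finSuccAboveOrderIso z), finSuccAboveOrderIso_apply]

theorem succAbove_spinPerm {g : ℕ} {f : Equiv.Perm (Fin (g+1))} {x y : Fin (g+1)} (hf : f x = y)
    (i : Fin g) : y.succAbove (spinPerm g f x y i) = f (x.succAbove i) := by
  rw [spinPerm, dif_pos hf, ← eIso_apply g y, ← eIso_apply g x]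
  exact congrArg Subtype.val ((eIso g y).apply_symm_apply _)

/-- The extension of `spinPerm g f x y` to `Fin (g+1)` fixing `0` is `f`, precomposed with the cycle
moving `0` to `x` and postcomposed with the cycle moving `y` to `0`. -/
theorem decomposeFin_symm_spinPerm {g : ℕ} {f : Equiv.Perm (Fin (g+1))} {x y : Fin (g+1)}
    (hf : f x = y) :
    Equiv.Perm.decomposeFin.symm (0, spinPerm g f x y) =
      y.cycleRange * f * x.cycleRange.symm := by
  ext1 i
  refine Fin.cases ?_ (fun i => ?_) i
  · simp [hf]
  · simp [← succAbove_spinPerm hf]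

theorem sign_spinPerm {g : ℕ} {f : Equiv.Perm (Fin (g+1))} {x y : Fin (g+1)} (hf : f x = y) :
    (spinPerm g f x y).sign = (-1) ^ (y : ℕ) * f.sign * (-1) ^ (x : ℕ) := by
  simpa [Equiv.Perm.decomposeFin.symm_sign] using
    congrArg Equiv.Perm.sign (decomposeFin_symm_spinPerm hf)

namespace WStep

variable {g : ℕ}

theorem formPerm_apply_src {t : WStep g} (ht : t.valid) : [t.q, t.r, t.s].formPerm t.q = t.r :=
  List.formPerm_apply_head _ _ _ ht

theorem sign_perm {t : WStep g} (ht : t.valid) :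
    t.perm.sign = (-1) ^ (t.tgt : ℕ) * (-1) ^ (t.src : ℕ) := by
  have hs : [t.q, t.r, t.s].formPerm.sign = 1 := by
    simp only [valid, List.nodup_cons, List.mem_cons] at ht
    simp [List.formPerm_cons_cons, Equiv.Perm.sign_swap (x := t.q) (y := t.r) (by grind),
      Equiv.Perm.sign_swap (x := t.r) (y := t.s) (by grind)]
  rw [perm, sign_spinPerm (formPerm_apply_src ht), hs, mul_one]
  rfl

theorem succAbove_perm {t : WStep g} (ht : t.valid) (i : Fin g) :
    t.r.succAbove (t.perm i) = [t.q, t.r, t.s].formPerm (t.q.succAbove i) :=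
  succAbove_spinPerm (formPerm_apply_src ht) i

end WStep

theorem wChainPerm_cons (g : ℕ) (t : WStep g) (l : List (WStep g)) :
    wChainPerm g (t :: l) = wChainPerm g l * t.perm := by
  simp [wChainPerm]

theorem wChainPerm_append (g : ℕ) (l m : List (WStep g)) :
    wChainPerm g (l ++ m) = wChainPerm g m * wChainPerm g l := by
  simp [wChainPerm]

theorem sign_wChainPerm_cons {g : ℕ} (t : WStep g) (l : List (WStep g))
    (hv : ∀ u ∈ t :: l, u.valid) (hc : List.IsChain (fun t u => t.tgt = u.src) (t :: l)) :
    (wChainPerm g (t :: l)).sign =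
      (-1) ^ (((t :: l).getLast (List.cons_ne_nil t l)).tgt : ℕ) * (-1) ^ (t.src : ℕ) := by
  induction l generalizing t with
  | nil => simpa [wChainPerm] using WStep.sign_perm (hv t (by simp))
  | cons u l ih =>
    rw [List.isChain_cons_cons] at hc
    rw [wChainPerm_cons, Equiv.Perm.sign_mul, ih u (fun v h => hv v (by simp_all)) hc.2,
      WStep.sign_perm (hv t (by simp)), hc.1, List.getLast_cons_cons, mul_assoc,
      ← mul_assoc (_ ^ (u.src : ℕ)), ← mul_pow]
    simp

theorem IsWChain.sign_wChainPerm {g : ℕ} {q₀ : Fin (g+1)} {l : List (WStep g)}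
    (hl : IsWChain g q₀ l) : (wChainPerm g l).sign = 1 := by
  cases l with
  | nil => simp [wChainPerm]
  | cons t l =>
    obtain ⟨hv, hc, hs, ht⟩ := hl
    rw [sign_wChainPerm_cons t l hv hc, hs t (by simp),
      ht _ (List.getLast?_eq_some_getLast (List.cons_ne_nil t l)), ← mul_pow]
    simp

theorem IsWChain.append {g : ℕ} {q₀ : Fin (g+1)} {l m : List (WStep g)}
    (hl : IsWChain g q₀ l) (hm : IsWChain g q₀ m) : IsWChain g q₀ (l ++ m) := by
  refine ⟨?_, List.isChain_append.2 ⟨hl.2.1, hm.2.1, ?_⟩, ?_, ?_⟩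
  · intro t ht
    exact (List.mem_append.1 ht).elim (hl.1 t) (hm.1 t)
  · intro t ht u hu
    rw [hl.2.2.2 t ht, hm.2.2.1 u hu]
  · cases l with
    | nil => exact hm.2.2.1
    | cons t l => exact hl.2.2.1
  · rcases m.eq_nil_or_concat with rfl | ⟨m, t, rfl⟩
    · simpa using hl.2.2.2
    · simpa using hm.2.2.2

theorem one_mem_wSpinGroupAt (g : ℕ) (q₀ : Fin (g+1)) : 1 ∈ wSpinGroupAt g q₀ :=
  ⟨[], ⟨by simp, .nil, by simp, by simp⟩, by simp [wChainPerm]⟩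

theorem mul_mem_wSpinGroupAt {g : ℕ} {q₀ : Fin (g+1)} {σ τ : Equiv.Perm (Fin g)}
    (hσ : σ ∈ wSpinGroupAt g q₀) (hτ : τ ∈ wSpinGroupAt g q₀) : σ * τ ∈ wSpinGroupAt g q₀ := by
  obtain ⟨l, hl, rfl⟩ := hσ
  obtain ⟨m, hm, rfl⟩ := hτ
  exact ⟨m ++ l, hm.append hl, wChainPerm_append g m l⟩

/-- Going from `q₀` to the vertex labelled `a` through the triangle with third vertex `b`, and back
through the triangle with third vertex `c`, produces the 3-cycle `(a b c)`. -/
theorem swap_mul_swap_mem_wSpinGroupAt {g : ℕ} (q₀ : Fin (g+1)) {a b c : Fin g}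
    (h : [a, b, c].Nodup) : Equiv.swap a b * Equiv.swap b c ∈ wSpinGroupAt g q₀ := by
  have inj := fun x y : Fin g => (Fin.succAbove_right_injective (p := q₀)).eq_iff (a := x) (b := y)
  have hne := q₀.succAbove_ne
  have hne' := q₀.ne_succAbove
  simp only [List.nodup_cons, List.mem_cons, List.not_mem_nil, not_or] at h
  let t : WStep g := ⟨q₀, q₀.succAbove a, q₀.succAbove b⟩
  let u : WStep g := ⟨q₀.succAbove a, q₀, q₀.succAbove c⟩
  have ht : t.valid := by simp [t, WStep.valid, hne', inj, h]
  have hu : u.valid := by simp [u, WStep.valid, hne, hne', inj, h]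
  refine ⟨[t, u], ⟨by simp [ht, hu], List.isChain_pair.2 rfl, by simp [t, WStep.src],
    by simp [u, WStep.tgt]⟩, ?_⟩
  ext1 i
  apply Fin.succAbove_right_injective (p := q₀)
  have h1 : q₀.succAbove (u.perm (t.perm i)) = _ := WStep.succAbove_perm hu _
  have h2 := WStep.succAbove_perm ht i
  simp only [wChainPerm, List.map_cons, List.map_nil, List.reverse_cons, List.reverse_nil,
    List.nil_append, List.cons_append, List.prod_cons, List.prod_nil, mul_one,
    Equiv.Perm.mul_apply]
  rw [h1]
  simp only [t, u] at h2 ⊢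
  rw [h2]
  simp only [List.formPerm_cons_cons, List.formPerm_singleton, mul_one, Equiv.Perm.mul_apply,
    Equiv.swap_apply_def]
  grind

theorem Equiv.Perm.IsThreeCycle.mem_wSpinGroupAt {g : ℕ} {σ : Equiv.Perm (Fin g)}
    (hσ : σ.IsThreeCycle) (q₀ : Fin (g+1)) : σ ∈ wSpinGroupAt g q₀ := by
  obtain ⟨a, ha⟩ := hσ.isCycle.nonempty_support
  rw [hσ.eq_swap_mul_swap_iff_mem_support.2 ha]
  exact swap_mul_swap_mem_wSpinGroupAt q₀ (hσ.nodup_iff_mem_support.2 ha)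

/-- For `g ≥ 3` and every vertex `q₀` of the Weierstrass spin graph (the complete graph on
`Fin (g+1)`), the Weierstrass spin group at `q₀` equals the alternating group on `Fin g`;
in particular it is isomorphic to `A_g`. -/
theorem wSpinGroupAt_eq_alternating (g : ℕ) (hg : 3 ≤ g) (q₀ : Fin (g+1)) :
    wSpinGroupAt g q₀ = (alternatingGroup (Fin g) : Set (Equiv.Perm (Fin g))) := by
  refine Set.Subset.antisymm ?_ fun σ hσ => ?_
  · rintro _ ⟨l, hl, rfl⟩
    exact Equiv.Perm.mem_alternatingGroup.2 hl.sign_wChainPerm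
  · rw [SetLike.mem_coe, ← Equiv.Perm.closure_three_cycles_eq_alternating] at hσ
    induction hσ using Subgroup.closure_induction'' with
    | mem σ h => exact h.mem_wSpinGroupAt q₀
    | inv_mem σ h => exact h.inv.mem_wSpinGroupAt q₀
    | one => exact one_mem_wSpinGroupAt g q₀
    | mul σ τ _ _ hσ hτ => exact mul_mem_wSpinGroupAt hσ hτ
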